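/- The quantity (Σ_{p prime, p ≤ √N} ⌊N/p⌋) / (N · log log N) tends to 1 as N → ∞. -/

import Mathlib

section Mertens

open Finset Real
open scoped Nat
open Nat (primesLE mem_primesLE prime_of_mem_primesLE one_lt_of_mem_primesLE
  primesLE_eq_filter_range primesLE_eq_filter_Ioc_zero)

/-- The sum of `log p / p` over the primes `p ≤ n`. -/
noncomputable def primeLogSum (n : ℕ) : ℝ := ∑ p ∈ primesLE n, log p / p

/-- The sum of `1 / p` over the primes `p ≤ n`. -/
noncomputable def primeReciprocalSum (n : ℕ) : ℝ := ∑ p ∈ primesLE n, 1 / (p : ℝ)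

theorem log_factorial_eq_sum_primesLE (n : ℕ) :
    log (n ! : ℝ) = ∑ p ∈ primesLE n, (n !).factorization p * log p := by
  rw [log_nat_eq_sum_factorization, Finsupp.sum, Nat.support_factorization]
  refine sum_subset (fun p hp ↦ ?_) fun p _ hp ↦ ?_
  · have := Nat.prime_of_mem_primeFactors hp
    exact mem_primesLE.mpr ⟨(this.dvd_factorial).mp (Nat.dvd_of_mem_primeFactors hp), this⟩
  · rw [← Nat.support_factorization, Finsupp.notMem_support_iff] at hp
    simp [hp]

theorem factorization_factorial_ge_div {n p : ℕ} (hp : p.Prime) :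
    n / p ≤ (n !).factorization p := by
  rw [Nat.factorization_factorial hp (Nat.lt_add_of_pos_right (n := Nat.log p n) two_pos)]
  simpa using single_le_sum (f := fun i ↦ n / p ^ i) (fun _ _ ↦ Nat.zero_le _)
    (mem_Ico.mpr ⟨le_refl 1, by lia⟩ : 1 ∈ Ico 1 (Nat.log p n + 2))

theorem factorization_factorial_le_div {n p : ℕ} (hp : p.Prime) :
    ((n !).factorization p : ℝ) ≤ n / (p - 1) := by
  have h1 : (1 : ℝ) < p := mod_cast hp.one_lt
  rw [le_div_iff₀ (by linarith)]
  have h : (p - 1) * (n !).factorization p ≤ n := by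
    rw [Nat.sub_one_mul_factorization_factorial hp]
    exact Nat.sub_le _ _
  have h' : (((p - 1 : ℕ) : ℝ)) * (n !).factorization p ≤ n := mod_cast h
  rw [Nat.cast_sub hp.one_lt.le] at h'
  push_cast at h'
  linarith

theorem primeLogSum_le {n : ℕ} (hn : 0 < n) : primeLogSum n ≤ log n + log 4 := by
  have hn' : (0 : ℝ) < n := mod_cast hn
  have key : n * primeLogSum n - Chebyshev.theta n ≤ n * log n := calc
    _ = ∑ p ∈ primesLE n, ((n : ℝ) / p - 1) * log p := by
      rw [primeLogSum, Chebyshev.theta_eq_sum_primesLE_log, mul_sum, ← sum_sub_distrib]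
      exact sum_congr rfl fun p _ ↦ by ring
    _ ≤ ∑ p ∈ primesLE n, (n !).factorization p * log p := by
      refine sum_le_sum fun p hp ↦ ?_
      gcongr
      have h1 : (n : ℝ) / p < (n / p : ℕ) + 1 := by
        rw [← Nat.floor_div_eq_div (K := ℝ)]
        exact Nat.lt_floor_add_one _
      have h2 : ((n / p : ℕ) : ℝ) ≤ (n !).factorization p :=
        mod_cast factorization_factorial_ge_div (prime_of_mem_primesLE hp)
      linarith
    _ = log (n ! : ℝ) := (log_factorial_eq_sum_primesLE n).symm
    _ ≤ log ((n : ℝ) ^ n) := log_le_log (by positivity) (mod_cast n.factorial_le_pow)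
    _ = n * log n := log_pow _ _
  have := Chebyshev.theta_le_log4_mul_x hn'.le
  refine le_of_mul_le_mul_left ?_ hn'
  linarith

theorem summable_log_div_mul_sub_one :
    Summable fun n : ℕ ↦ log n / ((n : ℝ) * (n - 1)) := by
  refine Summable.of_norm_bounded
    ((Real.summable_nat_rpow (p := -(3 / 2))).mpr (by norm_num) |>.mul_left 4) fun n ↦ ?_
  rcases Nat.lt_or_ge n 2 with h | h
  · interval_cases n <;> norm_num
  have hn : (2 : ℝ) ≤ n := mod_cast h
  have hn0 : (0 : ℝ) < n := by linarith
  have hlog := log_le_rpow_div hn0.le (ε := 1 / 2) (by norm_num)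
  have hlog0 : 0 ≤ log n := log_natCast_nonneg n
  have hpow : (n : ℝ) ^ (-(3 / 2) : ℝ) * (n * n) = (n : ℝ) ^ (1 / 2 : ℝ) := by
    rw [← pow_two, ← rpow_natCast, ← rpow_add hn0]
    norm_num
  have hpos : 0 < (n : ℝ) ^ (-(3 / 2) : ℝ) := by positivity
  rw [norm_of_nonneg (div_nonneg hlog0 (by nlinarith)), div_le_iff₀ (by nlinarith)]
  have : (n : ℝ) ^ (-(3 / 2) : ℝ) * (n * n) ≤ (n : ℝ) ^ (-(3 / 2) : ℝ) * (2 * (n * (n - 1))) :=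
    mul_le_mul_of_nonneg_left (by nlinarith) hpos.le
  linarith

theorem exists_le_primeLogSum : ∃ C, ∀ n : ℕ, 0 < n → log n - C ≤ primeLogSum n := by
  set T := ∑' n : ℕ, log n / ((n : ℝ) * (n - 1))
  refine ⟨1 + T, fun n hn ↦ ?_⟩
  have hn' : (0 : ℝ) < n := mod_cast hn
  have hterm (m : ℕ) : 0 ≤ log m / ((m : ℝ) * (m - 1)) := by
    rcases m.eq_zero_or_pos with rfl | hm
    · simp
    have : (1 : ℝ) ≤ m := mod_cast hm
    exact div_nonneg (log_natCast_nonneg m) (mul_nonneg (by linarith) (by linarith))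
  have hT : ∑ p ∈ primesLE n, log p / ((p : ℝ) * (p - 1)) ≤ T :=
    summable_log_div_mul_sub_one.sum_le_tsum _ fun m _ ↦ hterm m
  have hfac : n * log n - n ≤ log (n ! : ℝ) := by
    have h1 := Stirling.le_log_factorial_stirling hn.ne'
    have h2 : 0 ≤ log (2 * π) := log_nonneg (by linarith [pi_gt_three])
    have h3 : 0 ≤ log n := log_natCast_nonneg n
    linarith
  have key : log (n ! : ℝ) ≤ n * (primeLogSum n + T) := calc
    _ = ∑ p ∈ primesLE n, (n !).factorization p * log p := log_factorial_eq_sum_primesLE n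
    _ ≤ ∑ p ∈ primesLE n, n * (log p / p + log p / ((p : ℝ) * (p - 1))) := by
      refine sum_le_sum fun p hp ↦ ?_
      have h1 : (1 : ℝ) < p := mod_cast one_lt_of_mem_primesLE hp
      have h2 : (p : ℝ) - 1 ≠ 0 := by linarith
      calc
        _ ≤ n / ((p : ℝ) - 1) * log p := by
          gcongr
          exact factorization_factorial_le_div (prime_of_mem_primesLE hp)
        _ = _ := by
          field_simp
          ring
    _ = n * (primeLogSum n + ∑ p ∈ primesLE n, log p / ((p : ℝ) * (p - 1))) := by
      rw [← mul_sum, sum_add_distrib, primeLogSum]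
    _ ≤ _ := by gcongr
  refine le_of_mul_le_mul_left ?_ hn'
  linarith

theorem primeReciprocalSum_succ_sub (n : ℕ) :
    primeReciprocalSum (n + 1) - primeReciprocalSum n =
      (primeLogSum (n + 1) - primeLogSum n) / log (n + 1 : ℕ) := by
  simp only [primeReciprocalSum, primeLogSum, primesLE_eq_filter_range, sum_filter,
    sum_range_succ _ (n + 1), add_sub_cancel_left]
  split_ifs with h
  · have : log (n + 1 : ℕ) ≠ 0 := (log_pos (mod_cast h.one_lt)).ne'
    field_simp
  · simp

theorem primesLE_two : primesLE 2 = {2} := by decide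

theorem primeReciprocalSum_le {C : ℝ} (hC : ∀ n : ℕ, 0 < n → primeLogSum n ≤ log n + C)
    {n : ℕ} (hn : 2 ≤ n) :
    primeReciprocalSum n ≤ log (log n) + 1 + C / log 2 - log (log 2) := by
  have key : primeReciprocalSum n - primeLogSum n / log n ≤
      log (log n) - C / log n + C / log 2 - log (log 2) := by
    induction n, hn using Nat.le_induction with
    | base =>
      have : log 2 ≠ 0 := (log_pos one_lt_two).ne'
      simp [primeReciprocalSum, primeLogSum, primesLE_two]
      field_simp
      norm_num
    | succ n hn ih =>
      have hstep := primeReciprocalSum_succ_sub n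
      have hA := hC n (by lia)
      have hl : 0 < log n := log_pos (mod_cast hn)
      have hl' : log n ≤ log (n + 1 : ℕ) := log_le_log (by positivity) (mod_cast n.le_succ)
      have hl0 : 0 < log (n + 1 : ℕ) := hl.trans_le hl'
      have hr := one_sub_inv_le_log_of_pos (div_pos hl0 hl)
      rw [log_div hl0.ne' hl.ne', inv_div] at hr
      have hmul := mul_le_mul_of_nonneg_right hA (sub_nonneg.mpr (inv_anti₀ hl hl'))
      have hone : log n * (log n)⁻¹ = 1 := mul_inv_cancel₀ hl.ne'
      simp only [div_eq_mul_inv] at *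
      linarith
  have hl : 0 < log n := log_pos (mod_cast hn)
  have : primeLogSum n / log n ≤ 1 + C / log n := by
    rw [div_le_iff₀ hl, add_mul, div_mul_cancel₀ _ hl.ne']
    linarith [hC n (by lia)]
  linarith

theorem le_primeReciprocalSum {C : ℝ} (hC : ∀ n : ℕ, 0 < n → log (n + 1 : ℕ) - C ≤ primeLogSum n)
    {n : ℕ} (hn : 2 ≤ n) :
    log (log n) - C / log 2 - log (log 2) ≤ primeReciprocalSum n := by
  have key : log (log n) + C / log n - C / log 2 - log (log 2) ≤
      primeReciprocalSum n - primeLogSum n / log n := by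
    induction n, hn using Nat.le_induction with
    | base =>
      have : log 2 ≠ 0 := (log_pos one_lt_two).ne'
      simp [primeReciprocalSum, primeLogSum, primesLE_two]
      field_simp
      norm_num
    | succ n hn ih =>
      have hstep := primeReciprocalSum_succ_sub n
      have hA := hC n (by lia)
      have hl : 0 < log n := log_pos (mod_cast hn)
      have hl' : log n ≤ log (n + 1 : ℕ) := log_le_log (by positivity) (mod_cast n.le_succ)
      have hl0 : 0 < log (n + 1 : ℕ) := hl.trans_le hl'
      have hr := log_le_sub_one_of_pos (div_pos hl0 hl)
      rw [log_div hl0.ne' hl.ne'] at hr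
      have hmul := mul_le_mul_of_nonneg_right hA (sub_nonneg.mpr (inv_anti₀ hl hl'))
      have hone : log (n + 1 : ℕ) * (log (n + 1 : ℕ))⁻¹ = 1 := mul_inv_cancel₀ hl0.ne'
      simp only [div_eq_mul_inv] at *
      linarith
  have hl : 0 < log n := log_pos (mod_cast hn)
  have hl' : log n ≤ log (n + 1 : ℕ) := log_le_log (by positivity) (mod_cast n.le_succ)
  have : 0 ≤ primeLogSum n / log n + C / log n := by
    rw [← add_div]
    exact div_nonneg (by linarith [hC n (by lia)]) hl.le
  linarith

/-- **Mertens' second theorem**, with a bounded error term. -/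
theorem exists_abs_primeReciprocalSum_sub_log_log_le :
    ∃ K, ∀ n : ℕ, 2 ≤ n → |primeReciprocalSum n - log (log n)| ≤ K := by
  obtain ⟨C, hC⟩ := exists_le_primeLogSum
  have hC' (n : ℕ) (hn : 0 < n) : log (n + 1 : ℕ) - (C + log 2) ≤ primeLogSum n := by
    have : log (n + 1 : ℕ) ≤ log n + log 2 := by
      rw [← log_mul (by positivity) two_ne_zero]
      exact log_le_log (by positivity) (mod_cast (by lia))
    linarith [hC n hn]
  refine ⟨max (1 + log 4 / log 2 - log (log 2)) ((C + log 2) / log 2 + log (log 2)),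
    fun n hn ↦ abs_le'.mpr ⟨le_max_of_le_left ?_, le_max_of_le_right ?_⟩⟩
  · linarith [primeReciprocalSum_le (fun _ ↦ primeLogSum_le) hn]
  · linarith [le_primeReciprocalSum hC' hn]

theorem abs_log_log_sqrt_sub_log_log_le {n : ℕ} (hn : 4 ≤ n) :
    |log (log (Nat.sqrt n)) - log (log n)| ≤ log 4 := by
  have hm : 2 ≤ Nat.sqrt n := Nat.le_sqrt.mpr hn
  have hl : 0 < log (Nat.sqrt n) := log_pos (mod_cast hm)
  have hle : log (Nat.sqrt n) ≤ log n :=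
    log_le_log (by positivity) (mod_cast Nat.sqrt_le_self n)
  have hle4 : log n ≤ 4 * log (Nat.sqrt n) := by
    rw [show (4 : ℝ) = (4 : ℕ) by norm_num, ← log_pow]
    refine log_le_log (by positivity) ?_
    have h1 : n < (Nat.sqrt n + 1) ^ 2 := Nat.lt_succ_sqrt' n
    have h2 : Nat.sqrt n + 1 ≤ Nat.sqrt n ^ 2 := by nlinarith
    have h3 : (Nat.sqrt n + 1) ^ 2 ≤ (Nat.sqrt n ^ 2) ^ 2 := Nat.pow_le_pow_left h2 2
    exact_mod_cast h1.le.trans (h3.trans_eq (by ring))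
  rw [abs_sub_comm, abs_of_nonneg (sub_nonneg.mpr (log_le_log hl hle)), sub_le_iff_le_add,
    ← log_mul (by norm_num) hl.ne']
  exact log_le_log (hl.trans_le hle) hle4

theorem abs_sum_div_sub_mul_primeReciprocalSum_le {n m : ℕ} (hm : m ≤ n) :
    |∑ p ∈ primesLE m, ((n / p : ℕ) : ℝ) - n * primeReciprocalSum m| ≤ n := by
  rw [primeReciprocalSum, mul_sum, ← sum_sub_distrib]
  refine (abs_sum_le_sum_abs _ _).trans ((sum_le_card_nsmul _ _ 1 fun p _ ↦ ?_).trans ?_)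
  · have h1 : (n : ℝ) / p < (n / p : ℕ) + 1 := by
      rw [← Nat.floor_div_eq_div (K := ℝ)]
      exact Nat.lt_floor_add_one _
    have h2 : ((n / p : ℕ) : ℝ) ≤ (n : ℝ) / p := Nat.cast_div_le
    rw [mul_one_div, abs_le]
    constructor <;> linarith
  · rw [nsmul_eq_mul, mul_one, primesLE_eq_filter_Ioc_zero]
    exact_mod_cast (card_filter_le _ _).trans ((Nat.card_Ioc 0 m).le.trans hm)

end Mertens

open Filter in
/-- Running-time analysis of the factoring sieve:
`(Σ_{p prime, p ≤ √N} ⌊N/p⌋) / (N · log log N) → 1` as `N → ∞`. -/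
theorem sieve_work_asymptotic :
    Tendsto (fun N : ℕ =>
        (∑ p ∈ (Finset.range (Nat.sqrt N + 1)).filter Nat.Prime, ((N / p : ℕ) : ℝ)) /
          (N * Real.log (Real.log N)))
      atTop (nhds 1) := by
  obtain ⟨K, hK⟩ := exists_abs_primeReciprocalSum_sub_log_log_le
  have hloglog : Tendsto (fun N : ℕ ↦ Real.log (Real.log N)) atTop atTop :=
    Real.tendsto_log_atTop.comp (Real.tendsto_log_atTop.comp tendsto_natCast_atTop_atTop)
  rw [tendsto_iff_norm_sub_tendsto_zero]
  refine squeeze_zero' (.of_forall fun _ ↦ norm_nonneg _) ?_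
    (hloglog.const_div_atTop (1 + K + Real.log 4))
  filter_upwards [eventually_ge_atTop 4, hloglog.eventually_gt_atTop 0] with N hN hpos
  have hN0 : (0 : ℝ) < N := by positivity
  rw [← Nat.primesLE_eq_filter_range, div_sub_one (by positivity), Real.norm_eq_abs, abs_div,
    abs_of_pos (mul_pos hN0 hpos), div_le_div_iff₀ (by positivity) hpos]
  have h1 := abs_sum_div_sub_mul_primeReciprocalSum_le (Nat.sqrt_le_self N)
  have h2 := mul_le_mul_of_nonneg_left (hK _ (Nat.le_sqrt.mpr hN)) hN0.le
  have h3 := mul_le_mul_of_nonneg_left (abs_log_log_sqrt_sub_log_log_le hN) hN0.le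
  rw [← abs_of_pos hN0, ← abs_mul, abs_of_pos hN0] at h2 h3
  have h : |∑ p ∈ Nat.primesLE (Nat.sqrt N), ((N / p : ℕ) : ℝ) - N * Real.log (Real.log N)| ≤
      N * (1 + K + Real.log 4) := by
    rw [abs_le] at *
    constructor <;> linarith
  nlinarith
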